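/- Let Λ be the Leech lattice and let φ ∈ O(Λ) be an isometry of order 5. Then the coinvariant lattice S_φ(Λ) has rank 16, 20, or 24. Moreover, if the rank is 20 then the invariant lattice T_φ(Λ) is isometric to the rank-4 lattice with Gram matrix [[−4,−1,−1,1],[−1,−4,1,−1],[−1,1,−4,−1],[1,−1,−1,−4]], and if the rank is 24 then S_φ(Λ) = Λ. -/

import Mathlib

open Matrix Module

/-- The orthogonal complement of a submodule with respect to a bilinear form. -/
def orthSub {M : Type*} [AddCommGroup M] (b : M →ₗ[ℤ] M →ₗ[ℤ] ℤ)
    (T : Submodule ℤ M) : Submodule ℤ M where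
  carrier := {x | ∀ y ∈ T, b x y = 0}
  add_mem' := by
    intro a c ha hc y hy
    simp only [Set.mem_setOf_eq] at *
    rw [map_add, LinearMap.add_apply, ha y hy, hc y hy, add_zero]
  zero_mem' := by intro y hy; simp
  smul_mem' := by
    intro k x hx y hy
    simp only [Set.mem_setOf_eq] at hx
    rw [_root_.map_smul, LinearMap.smul_apply, hx y hy, smul_zero]

/-- The invariant lattice `T_φ` of an isometry. -/
def fixSub {M : Type*} [AddCommGroup M] (φ : M ≃ₗ[ℤ] M) : Submodule ℤ M :=
  LinearMap.ker (φ.toLinearMap - LinearMap.id)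

/-- The Gram matrix of the rank-4 invariant lattice of an order-5 isometry of the
Leech lattice with coinvariant lattice of rank 20. -/
def M5n : Matrix (Fin 4) (Fin 4) ℤ :=
  !![-4,-1,-1,1; -1,-4,1,-1; -1,1,-4,-1; 1,-1,-1,-4]

set_option linter.all false
set_option linter.unusedSimpArgs false

def EqvM (A B : Matrix (Fin 4) (Fin 4) ℤ) : Prop := ∃ U : Matrix (Fin 4) (Fin 4) ℤ, IsUnit U.det ∧ B = U * A * Uᵀ

lemma EqvM.refl (A) : EqvM A A := ⟨1, by simp, by simp⟩

lemma EqvM.step {A B : Matrix (Fin 4) (Fin 4) ℤ} (h : EqvM A B) (L : Matrix (Fin 4) (Fin 4) ℤ)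
    (hL : L.det = 1 ∨ L.det = -1) : EqvM A (L * B * Lᵀ) := by
  obtain ⟨U, hU, rfl⟩ := h
  refine ⟨L * U, ?_, ?_⟩
  · rw [Matrix.det_mul]
    exact (Int.isUnit_iff.2 hL).mul hU
  · rw [Matrix.transpose_mul]; simp only [Matrix.mul_assoc]

def PD (A : Matrix (Fin 4) (Fin 4) ℤ) : Prop := A.IsSymm ∧ ∀ x, x ≠ 0 → 0 < x ⬝ᵥ A *ᵥ x

lemma EqvM.pd {A B : Matrix (Fin 4) (Fin 4) ℤ} (h : EqvM A B) (hA : PD A) : PD B := by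
  obtain ⟨U, hU, rfl⟩ := h
  refine ⟨?_, ?_⟩
  · unfold Matrix.IsSymm
    rw [Matrix.transpose_mul, Matrix.transpose_mul, Matrix.transpose_transpose, hA.1.eq, Matrix.mul_assoc]
  · intro x hx
    have h1 : Uᵀ *ᵥ x ≠ 0 := by
      intro h0
      apply hx
      exact Matrix.eq_zero_of_mulVec_eq_zero (by rw [Matrix.det_transpose]; exact hU.ne_zero) h0
    have := hA.2 _ h1
    rw [← Matrix.mulVec_mulVec, ← Matrix.mulVec_mulVec, Matrix.dotProduct_mulVec x U, ← Matrix.mulVec_transpose]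
    exact this

lemma EqvM.det {A B : Matrix (Fin 4) (Fin 4) ℤ} (h : EqvM A B) : B.det = A.det := by
  obtain ⟨U, hU, rfl⟩ := h
  rw [Matrix.det_mul, Matrix.det_mul, Matrix.det_transpose]
  rcases Int.isUnit_iff.1 hU with h | h <;> rw [h] <;> ring

def dd1 (A : Matrix (Fin 4) (Fin 4) ℤ) : ℤ := A 0 0
def dd2 (A : Matrix (Fin 4) (Fin 4) ℤ) : ℤ := A 0 0 * A 1 1 - A 0 1 ^ 2
def dd3 (A : Matrix (Fin 4) (Fin 4) ℤ) : ℤ := A 0 0 * A 1 1 * A 2 2 + 2 * A 0 1 * A 0 2 * A 1 2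
  - A 0 0 * A 1 2 ^ 2 - A 1 1 * A 0 2 ^ 2 - A 2 2 * A 0 1 ^ 2

lemma det_four (A : Matrix (Fin 4) (Fin 4) ℤ) (h : A.IsSymm) :
   A.det = A 3 3 * dd3 A -
    (A 0 3 ^ 2 * (A 1 1 * A 2 2 - A 1 2 ^ 2) + A 1 3 ^ 2 * (A 0 0 * A 2 2 - A 0 2 ^ 2)
     + A 2 3 ^ 2 * (A 0 0 * A 1 1 - A 0 1 ^ 2)
     + 2 * A 0 3 * A 1 3 * (A 0 2 * A 1 2 - A 0 1 * A 2 2)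
     + 2 * A 0 3 * A 2 3 * (A 0 1 * A 1 2 - A 0 2 * A 1 1)
     + 2 * A 1 3 * A 2 3 * (A 0 1 * A 0 2 - A 0 0 * A 1 2)) := by
  have h1 := h.apply 0 1
  have h2 := h.apply 0 2
  have h3 := h.apply 0 3
  have h4 := h.apply 1 2
  have h5 := h.apply 1 3
  have h6 := h.apply 2 3
  rw [Matrix.det_succ_row_zero]
  simp [Fin.sum_univ_four, Matrix.det_fin_three, Fin.succAbove, dd3]
  simp [Fin.lt_def, h1, h2, h3, h4, h5, h6]
  ring

lemma quad_four (A : Matrix (Fin 4) (Fin 4) ℤ) (h : A.IsSymm) (a b c d : ℤ) :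
   ![a,b,c,d] ⬝ᵥ A *ᵥ ![a,b,c,d] = a^2 * A 0 0 + b^2 * A 1 1 + c^2 * A 2 2 + d^2 * A 3 3
     + 2*a*b*A 0 1 + 2*a*c*A 0 2 + 2*a*d*A 0 3 + 2*b*c*A 1 2+2*b*d*A 1 3+2*c*d*A 2 3 := by
  have h1 := h.apply 0 1
  have h2 := h.apply 0 2
  have h3 := h.apply 0 3
  have h4 := h.apply 1 2
  have h5 := h.apply 1 3
  have h6 := h.apply 2 3
  simp [Matrix.mulVec, dotProduct, Fin.sum_univ_four, h1, h2, h3, h4, h5, h6]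
  ring

lemma PD.pos1 {A} (h : PD A) : 0 < dd1 A := by
  have := h.2 ![1,0,0,0] (by intro h; simpa using congrFun h 0)
  rw [quad_four A h.1] at this
  simpa [dd1] using this

lemma PD.pos2 {A} (h : PD A) : 0 < dd2 A := by
  have h1 := h.pos1
  have := h.2 ![-A 0 1, A 0 0,0,0] (by intro h; have := congrFun h 1; simp at this; exact h1.ne' this)
  rw [quad_four A h.1] at this
  have e : 0 < dd1 A * dd2 A := by
    simp only [dd1, dd2]; linarith
  exact pos_of_mul_pos_right e h1.le

lemma PD.pos3 {A} (h : PD A) : 0 < dd3 A := by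
  have h1 := h.pos2
  have := h.2 ![A 0 1 * A 1 2 - A 1 1 * A 0 2, A 0 1 * A 0 2 - A 0 0 * A 1 2 , dd2 A,0] (by intro h; have := congrFun h 2; simp at this; exact h1.ne' this)
  rw [quad_four A h.1] at this
  have e : 0 < dd2 A * dd3 A := by
    simp only [dd3, dd2] at *; linarith
  exact pos_of_mul_pos_right e h1.le

lemma round_ex (f d : ℤ) (hd : 0 < d) : ∃ k : ℤ, 4 * (f + k * d) ^ 2 ≤ d ^ 2 := by
  refine ⟨-((2 * f + d) / (2 * d)), ?_⟩
  have h1 := Int.emod_add_mul_ediv (2 * f + d) (2 * d)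
  have h2 := Int.emod_nonneg (2 * f + d) (b := 2 * d) (by omega)
  have h3 := Int.emod_lt_of_pos (2 * f + d) (b := 2 * d) (by omega)
  set q := (2 * f + d) / (2 * d)
  set r := (2 * f + d) % (2 * d)
  have e : 2 * (f + -q * d) = r - d := by linarith
  have : 4 * (f + -q * d) ^ 2 = (r - d) ^ 2 := by rw [← e]; ring
  rw [this]
  apply sq_le_sq'  <;> linarith

lemma lll (A : Matrix (Fin 4) (Fin 4) ℤ) (hA : PD A) : ∃ B, EqvM A B ∧
    3 * dd1 B ^ 2 ≤ 4 * dd2 B ∧ 3 * dd2 B ^ 2 ≤ 4 * dd1 B * dd3 B ∧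
    3 * dd3 B ^ 2 ≤ 4 * dd2 B * A.det := by
  obtain ⟨B, hB, hmin⟩ := WellFounded.has_min (measure (fun B => (dd1 B + dd2 B + dd3 B).toNat)).wf
    {B | EqvM A B} ⟨A, EqvM.refl A⟩
  have hmin' : ∀ C, EqvM A C → dd1 B + dd2 B + dd3 B ≤ dd1 C + dd2 C + dd3 C := by
    intro C hC
    have := hmin C hC
    simp only [measure, InvImage, WellFoundedRelation.rel, invImage] at this
    have := (hC.pd hA).pos1
    have := (hC.pd hA).pos2
    have := (hC.pd hA).pos3
    have := (EqvM.pd hB hA).pos1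
    have := (EqvM.pd hB hA).pos2
    have := (EqvM.pd hB hA).pos3
    simp at *
    omega
  have pB := EqvM.pd hB hA
  have dB := EqvM.det hB
  have p1 := pB.pos1
  have p2 := pB.pos2
  have p3 := pB.pos3
  have h := pB.1
  have s1 := h.apply 0 1
  have s2 := h.apply 0 2
  have s3 := h.apply 0 3
  have s4 := h.apply 1 2
  have s5 := h.apply 1 3
  have s6 := h.apply 2 3
  refine ⟨B, hB, ?_, ?_, ?_⟩
  · obtain ⟨k, hk⟩ := round_ex (B 0 1) (dd1 B) p1
    have := hmin' _ (EqvM.step hB !![k,1,0,0;1,0,0,0;0,0,1,0;0,0,0,1] (by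
      right; simp [Matrix.det_succ_row_zero, Fin.sum_univ_succ, Fin.succAbove]))
    simp [dd1, dd2, dd3, Matrix.mul_apply, Fin.sum_univ_four, Matrix.vecMul, dotProduct, s1, s2, s3, s4, s5, s6] at this hk ⊢
    have e : B 0 0 ≤ B 0 0 * k ^ 2 + 2 * k * B 0 1 + B 1 1 := by linarith
    have := mul_le_mul_of_nonneg_left e p1.le
    simp only [dd1] at this
    nlinarith
  · obtain ⟨k, hk⟩ := round_ex (B 0 0 * B 1 2 - B 0 1 * B 0 2) (dd2 B) p2
    have := hmin' _ (EqvM.step hB !![1,0,0,0;0,k,1,0;0,1,0,0;0,0,0,1] (by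
      right; simp [Matrix.det_succ_row_zero, Fin.sum_univ_succ, Fin.succAbove]))
    simp [dd1, dd2, dd3, Matrix.mul_apply, Fin.sum_univ_four, Matrix.vecMul, dotProduct, s1, s2, s3, s4, s5, s6] at this hk
    have e : dd2 B ≤ (B 0 0 * B 2 2 - B 0 2 ^ 2) + 2 * k * (B 0 0 * B 1 2 - B 0 1 * B 0 2) + k ^ 2 * dd2 B := by
      simp only [dd2]; linarith
    have := mul_le_mul_of_nonneg_left e p2.le
    simp only [dd1, dd2, dd3] at this ⊢
    linarith
  · obtain ⟨k, hk⟩ := round_ex (A.det * 0 + (B 2 3 * dd2 B + B 0 3 * (B 0 1 * B 1 2 - B 0 2 * B 1 1) + B 1 3 * (B 0 1 * B 0 2 - B 0 0 * B 1 2))) (dd3 B) p3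
    have := hmin' _ (EqvM.step hB !![1,0,0,0;0,1,0,0;0,0,k,1;0,0,1,0] (by
      right; simp [Matrix.det_succ_row_zero, Fin.sum_univ_succ, Fin.succAbove]))
    simp [dd1, dd2, dd3, Matrix.mul_apply, Fin.sum_univ_four, Matrix.vecMul, dotProduct, s1, s2, s3, s4, s5, s6] at this hk
    have e : dd3 B ≤ (B 0 0 * B 1 1 * B 3 3 + 2 * B 0 1 * B 0 3 * B 1 3 - B 0 0 * B 1 3 ^ 2 - B 1 1 * B 0 3 ^ 2 - B 3 3 * B 0 1 ^ 2) + 2 * k * (B 2 3 * dd2 B + B 0 3 * (B 0 1 * B 1 2 - B 0 2 * B 1 1) + B 1 3 * (B 0 1 * B 0 2 - B 0 0 * B 1 2)) + k ^ 2 * dd3 B := by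
      simp only [dd2, dd3]; linarith
    have := mul_le_mul_of_nonneg_left e p3.le
    rw [← dB, det_four B h]
    simp only [dd1, dd2, dd3] at this hk ⊢
    linarith


def cartan : Matrix (Fin 4) (Fin 4) ℤ := !![2,-1,0,0;-1,2,-1,0;0,-1,2,-1;0,0,-1,2]

lemma red_cartan (A : Matrix (Fin 4) (Fin 4) ℤ) (hA : PD A) (hd : A.det = 5)
    (h1 : dd1 A = 2) (h2 : dd2 A = 3) (h3 : dd3 A = 4) : EqvM A cartan := by
  -- step 1
  have key : ∀ B L, EqvM A B → (L.det = 1 ∨ L.det = -1) → EqvM A (L * B * Lᵀ) :=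
    fun B L h hL => h.step L hL
  have e1 : ∃ B, EqvM A B ∧ B 0 0 = 2 ∧ B 0 1 = -1 ∧ B 1 1 = 2 ∧ dd3 B = 4 := by
    have h := hA.1
    have s1 := h.apply 0 1
    have s2 := h.apply 0 2
    have s4 := h.apply 1 2
    have hodd : A 0 1 % 2 = 1 := by
      simp only [dd1, dd2] at h1 h2
      rw [h1] at h2
      rcases Int.emod_two_eq_zero_or_one (A 0 1) with h | h
      · obtain ⟨c, hc⟩ := Int.dvd_of_emod_eq_zero h
        rw [hc] at h2
        ring_nf at h2
        omega
      · exact h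
    obtain ⟨k, hk⟩ : ∃ k, A 0 1 = -1 - 2 * k := ⟨-(A 0 1 + 1) / 2, by omega⟩
    refine ⟨_, key A !![1,0,0,0;k,1,0,0;0,0,1,0;0,0,0,1] (EqvM.refl A) (by
      left; simp [Matrix.det_succ_row_zero, Fin.sum_univ_succ, Fin.succAbove]), ?_⟩
    simp [dd1, dd2, dd3, Matrix.mul_apply, Fin.sum_univ_four, Matrix.vecMul, dotProduct, s1, s2, s4] at h1 h2 h3 ⊢
    rw [h1] at h2 h3 ⊢
    rw [hk] at h2 h3 ⊢
    refine ⟨rfl, by ring, by linarith, ?_⟩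
    linarith
  obtain ⟨B, hB, b00, b01, b11, bd3⟩ := e1
  have e2 : ∃ B, EqvM A B ∧ B 0 0 = 2 ∧ B 0 1 = -1 ∧ B 1 1 = 2 ∧ B 0 2 = 0 ∧ B 1 2 = -1 ∧ B 2 2 = 2 := by
    have h := (hB.pd hA).1
    have s1 := h.apply 0 1
    have s2 := h.apply 0 2
    have s4 := h.apply 1 2
    obtain ⟨e, k, he, hk⟩ : ∃ e k : ℤ, (e = 1 ∨ e = -1 ∨ e = 0) ∧ B 1 2 + 2 * B 0 2 = - e - 3 * k := by
      generalize B 1 2 + 2 * B 0 2 = t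
      have : t % 3 = 0 ∨ t % 3 = 1 ∨ t % 3 = 2 := by omega
      rcases this with h | h | h
      · exact ⟨0, -t / 3, by simp, by omega⟩
      · exact ⟨-1, (1-t) / 3, by simp, by omega⟩
      · exact ⟨1, (-1-t)/3, by simp, by omega⟩
    have hk' : B 1 2 = - e - 3 * k - 2 * B 0 2 := by linarith
    simp only [dd3, b00, b01, b11, hk'] at bd3
    have he' : e = 1 ∨ e = -1 := by
      rcases he with h | h | h
      · simp [h]
      · simp [h]
      · exfalso
        rw [h] at bd3
        ring_nf at bd3
        omega
    refine ⟨_, key B !![1,0,0,0;0,1,0,0;e*k,e*(B 0 2+2*k),e,0;0,0,0,1] hB (by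
      rcases he' with rfl | rfl <;>
       simp [Matrix.det_succ_row_zero, Fin.sum_univ_succ, Fin.succAbove]), ?_⟩
    simp [Matrix.mul_apply, Fin.sum_univ_four, Matrix.vecMul, dotProduct, s1, s2, s4, b00, b01, b11, hk']
    rcases he' with rfl | rfl <;> refine ⟨by ring, by ring, ?_⟩ <;> linarith
  clear hB b00 b01 b11 bd3 B
  obtain ⟨B, hB, b00, b01, b11, b02, b12, b22⟩ := e2
  have h := (hB.pd hA).1
  have s1 := h.apply 0 1
  have s2 := h.apply 0 2
  have s3 := h.apply 0 3
  have s4 := h.apply 1 2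
  have s5 := h.apply 1 3
  have s6 := h.apply 2 3
  have hdet := hB.det
  rw [det_four B h, hd] at hdet
  obtain ⟨e, k, he, hk⟩ : ∃ e k : ℤ, (e = 1 ∨ e = -1 ∨ e = 0 ∨ e = 2) ∧ B 2 3 + 2 * B 1 3 + 3 * B 0 3 = - e - 4 * k := by
    generalize B 2 3 + 2 * B 1 3 + 3 * B 0 3 = t
    have : t % 4 = 0 ∨ t % 4 = 1 ∨ t % 4 = 2 ∨ t % 4 = 3 := by omega
    rcases this with h | h | h | h
    · exact ⟨0, -t / 4, by simp, by omega⟩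
    · exact ⟨-1, (1-t) / 4, by simp, by omega⟩
    · exact ⟨2, (-2-t) / 4, by simp, by omega⟩
    · exact ⟨1, (-1-t) / 4, by simp, by omega⟩
  have hk' : B 2 3 = - e - 4 * k - 2 * B 1 3 - 3 * B 0 3 := by linarith
  simp only [dd3, b00, b01, b11, b02, b12, b22, hk'] at hdet
  have he' : e = 1 ∨ e = -1 := by
    rcases he with h | h | h | h
    · simp [h]
    · simp [h]
    all_goals
      exfalso
      rw [h] at hdet
      ring_nf at hdet
      omega
  have := key B !![1,0,0,0;0,1,0,0;0,0,1,0;e*k,e*(B 0 3+2*k),e*(B 1 3 + 2*B 0 3+3*k),e] hB (by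
      rcases he' with rfl | rfl <;>
       simp [Matrix.det_succ_row_zero, Fin.sum_univ_succ, Fin.succAbove])
  convert this using 1
  have h33 : ∀ x, x = B 3 3 → x = B 3 3 := fun x h => h
  ext i j
  fin_cases i <;> fin_cases j <;>
    simp [cartan, Matrix.mul_apply, Fin.sum_univ_four, Matrix.vecMul, dotProduct, s1, s2, s3, s4, s5, s6, b00, b01, b11, b02, b12, b22, hk'] <;>
    rcases he' with rfl | rfl <;> linarith

lemma five_eq : (5 : Matrix (Fin 4) (Fin 4) ℤ) = (5:ℤ) • (1 : Matrix (Fin 4) (Fin 4) ℤ) := by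
  rw [smul_eq_diagonal_mul]; simp; rfl

lemma rank4_final (G A : Matrix (Fin 4) (Fin 4) ℤ) (hG : PD G) (hG4 : ∀ x, x ≠ 0 → 4 ≤ x ⬝ᵥ G *ᵥ x)
    (hA : PD A) (hAe : ∀ x, Even (x ⬝ᵥ A *ᵥ x)) (hAG : A * G = 5) :
    ∃ U : Matrix (Fin 4) (Fin 4) ℤ, IsUnit U.det ∧ U * G * Uᵀ = !![4,1,1,-1; 1,4,-1,1; 1,-1,4,1; -1,1,1,4] := by
  have hdet : A.det * G.det = 625 := by
    rw [← Matrix.det_mul, hAG]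
    rw [five_eq, Matrix.det_smul]; simp
  have hGd : 46 ≤ G.det := by
    obtain ⟨B, hB, i1, i2, i3⟩ := lll G hG
    have p1 := (hB.pd hG).pos1
    have p2 := (hB.pd hG).pos2
    have p3 := (hB.pd hG).pos3
    have h4 : 4 ≤ dd1 B := by
      obtain ⟨U, hU, rfl⟩ := hB
      have := hG4 (Uᵀ *ᵥ ![1,0,0,0]) (by
        intro h0
        have := Matrix.eq_zero_of_mulVec_eq_zero (by rw [Matrix.det_transpose]; exact hU.ne_zero) h0
        simpa using congrFun this 0)
      have e : (Uᵀ *ᵥ ![1,0,0,0]) ⬝ᵥ G *ᵥ (Uᵀ *ᵥ ![1,0,0,0]) = dd1 (U * G * Uᵀ) := by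
        rw [Matrix.mulVec_transpose, ← Matrix.dotProduct_mulVec, ← Matrix.mulVec_transpose,
          Matrix.mulVec_mulVec, Matrix.mulVec_mulVec]
        simp [dd1, Matrix.mulVec, dotProduct, Fin.sum_univ_four]
      omega
    generalize dd1 B = a at *
    generalize dd2 B = b at *
    generalize dd3 B = c at *
    by_contra! hlt
    generalize G.det = d at *
    have hb : 12 ≤ b := by nlinarith
    -- 27 b^3 ≤ 64 a^2 d ... 
    have k1 : 9 * b ^ 4 ≤ 16 * a ^ 2 * c ^ 2 := by nlinarith [pow_le_pow_left₀ (by positivity) i2 2]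
    have k2 : 9 * b ^ 4 * 3 ≤ 16 * a ^ 2 * (4 * b * d) := by nlinarith [mul_le_mul_of_nonneg_left i3 (by positivity : 0 ≤ 16 * a^2)]
    have k3 : 27 * b ^ 3 ≤ 64 * a ^ 2 * d := by
      have : b * (27 * b ^ 3) ≤ b * (64 * a ^ 2 * d) := by nlinarith
      exact le_of_mul_le_mul_left this p2
    have k4 : 64 * a ^ 2 * d ≤ 64 * a ^ 2 * 45 := by
      apply mul_le_mul_of_nonneg_left (by omega) (by positivity)
    have k5 : 27 * b ^ 3 * 3 ≤ 64 * 45 * (4 * b) := by nlinarith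
    have k6 : 81 * b ^ 2 ≤ 11520 := by
      have : b * (81 * b ^ 2) ≤ b * 11520 := by nlinarith
      exact le_of_mul_le_mul_left this p2
    nlinarith
  have hAd : A.det ≤ 13 ∧ 0 < A.det := by constructor <;> nlinarith
  have hAd' : A.det = 1 ∨ A.det = 5 := by
    have : A.det ∣ 625 := ⟨_, hdet.symm⟩
    obtain ⟨l, r⟩ := hAd
    generalize A.det = t at *
    interval_cases t <;> omega
  obtain ⟨B, hB, i1, i2, i3⟩ := lll A hA
  have p1 := (hB.pd hA).pos1
  have p2 := (hB.pd hA).pos2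
  have p3 := (hB.pd hA).pos3
  have h4 : Even (dd1 B) := by
    obtain ⟨U, hU, rfl⟩ := hB
    have := hAe (Uᵀ *ᵥ ![1,0,0,0])
    have e : (Uᵀ *ᵥ ![1,0,0,0]) ⬝ᵥ A *ᵥ (Uᵀ *ᵥ ![1,0,0,0]) = dd1 (U * A * Uᵀ) := by
      rw [Matrix.mulVec_transpose, ← Matrix.dotProduct_mulVec, ← Matrix.mulVec_transpose,
          Matrix.mulVec_mulVec, Matrix.mulVec_mulVec]
      simp [dd1, Matrix.mulVec, dotProduct, Fin.sum_univ_four]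
    rwa [← e]
  have hd2 : A.det = 5 ∧ dd1 B = 2 ∧ dd2 B = 3 ∧ dd3 B = 4 := by
    have h2 : 2 ≤ dd1 B := by
      obtain ⟨r, hr⟩ := h4
      omega
    have hd5 : A.det ≤ 5 := by omega
    have hA0 := hAd.2
    generalize dd1 B = a at *
    generalize dd2 B = b at *
    generalize dd3 B = c at *
    generalize A.det = d at *
    have k1 : 9 * b ^ 4 ≤ 16 * a ^ 2 * c ^ 2 := by nlinarith [pow_le_pow_left₀ (by positivity) i2 2]
    have k2 : 9 * b ^ 4 * 3 ≤ 16 * a ^ 2 * (4 * b * d) := by nlinarith [mul_le_mul_of_nonneg_left i3 (by positivity : 0 ≤ 16 * a^2)]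
    have k3 : 27 * b ^ 3 ≤ 64 * a ^ 2 * d := by
      have : b * (27 * b ^ 3) ≤ b * (64 * a ^ 2 * d) := by nlinarith
      exact le_of_mul_le_mul_left this p2
    have k4 : 64 * a ^ 2 * d ≤ 64 * a ^ 2 * 5 := by
      apply mul_le_mul_of_nonneg_left (by omega) (by positivity)
    have k5 : 27 * b ^ 3 * 3 ≤ 64 * 5 * (4 * b) := by nlinarith
    have k6 : 81 * b ^ 2 ≤ 1280 := by
      have : b * (81 * b ^ 2) ≤ b * 1280 := by nlinarith
      exact le_of_mul_le_mul_left this p2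
    have hb3 : b ≤ 3 := by nlinarith
    have ha2 : a = 2 := by nlinarith
    subst ha2
    have hb : b = 3 := by omega
    subst hb
    have hc : c ≤ 4 := by nlinarith
    have hc' : 4 ≤ c := by omega
    have : c = 4 := by omega
    subst this
    refine ⟨?_, rfl, rfl, rfl⟩
    omega
  have hC0 : EqvM B cartan := red_cartan B (hB.pd hA) (by rw [hB.det]; exact hd2.1) hd2.2.1 hd2.2.2.1 hd2.2.2.2
  obtain ⟨V, hV, hVB⟩ := hC0
  obtain ⟨W, hW, rfl⟩ := hB
  obtain ⟨U, hU, hUA⟩ : ∃ U : Matrix (Fin 4) (Fin 4) ℤ, IsUnit U.det ∧ cartan = U * A * Uᵀ :=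
    ⟨V * W, by rw [Matrix.det_mul]; exact hV.mul hW, by rw [hVB, Matrix.transpose_mul]; simp only [Matrix.mul_assoc]⟩
  have hUu : U⁻¹ * U = 1 := Matrix.nonsing_inv_mul _ hU
  have hUu' : U * U⁻¹ = 1 := Matrix.mul_nonsing_inv _ hU
  set X := U⁻¹
  have t1 : Uᵀ * Xᵀ = 1 := by rw [← Matrix.transpose_mul, hUu, Matrix.transpose_one]
  have hC : cartan * (Xᵀ * G * X) = 5 := by
    calc cartan * (Xᵀ * G * X) = U * A * (Uᵀ * Xᵀ) * G * X := by rw [hUA]; simp only [Matrix.mul_assoc]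
      _ = U * (A * G) * X := by rw [t1]; simp only [Matrix.mul_assoc, Matrix.one_mul]
      _ = 5 := by
        rw [hAG]
        rw [show U * 5 = 5 * U from (Commute.ofNat_right U 5).eq, Matrix.mul_assoc, hUu', Matrix.mul_one]
  let N : Matrix (Fin 4) (Fin 4) ℤ := !![4,3,2,1;3,6,4,2;2,4,6,3;1,2,3,4]
  have hNC : N * cartan = 5 := by decide
  have hX : Xᵀ * G * X = N := by
    have h1 : N * cartan * (Xᵀ * G * X) = N * 5 := by rw [Matrix.mul_assoc, hC]
    rw [hNC, show N * 5 = 5 * N from (Commute.ofNat_right N 5).eq] at h1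
    ext i j
    have := congrFun (congrFun h1 i) j
    rw [five_eq, smul_mul_assoc, smul_mul_assoc, Matrix.one_mul, Matrix.one_mul, Matrix.smul_apply,
      Matrix.smul_apply, smul_eq_mul, smul_eq_mul] at this
    omega
  let P : Matrix (Fin 4) (Fin 4) ℤ := !![1,0,0,0;1,-1,0,0;0,1,-1,0;0,0,-1,1]
  refine ⟨P * Xᵀ, ?_, ?_⟩
  · rw [Matrix.det_mul, Matrix.det_transpose]
    have : IsUnit X.det := by
      have := congrArg Matrix.det hUu
      rw [Matrix.det_mul, Matrix.det_one] at this
      exact IsUnit.of_mul_eq_one _ this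
    refine IsUnit.mul ?_ this
    decide
  · rw [Matrix.transpose_mul, Matrix.transpose_transpose]
    rw [show P * Xᵀ * G * (X * Pᵀ) = P * (Xᵀ * G * X) * Pᵀ by simp only [Matrix.mul_assoc], hX]
    decide


open MeasureTheory in
lemma sigma_int (m : ℕ) (hm : 0 < m) :
    ∫⁻ y : EuclideanSpace ℝ (Fin (2 * m)), ENNReal.ofReal (1 - ‖y‖ ^ 2 / 2)
      = ENNReal.ofReal (Real.pi ^ m / (m.factorial : ℝ) * (2 ^ m / (m + 1))) := by
  haveI : Nonempty (Fin (2 * m)) := ⟨⟨0, by omega⟩⟩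
  have e : ∀ y : EuclideanSpace ℝ (Fin (2 * m)), ENNReal.ofReal (1 - ‖y‖ ^ 2 / 2)
     = ENNReal.ofReal (max (1 - ‖y‖ ^ 2 / 2) 0) := by
    intro y
    simp [ENNReal.ofReal_max]
  simp_rw [e]
  rw [← ofReal_integral_eq_lintegral_ofReal]
  · congr 1
    rw [integral_fun_norm_addHaar volume (fun r => max (1 - r ^ 2 / 2) 0)]
    have hv : (volume : Measure (EuclideanSpace ℝ (Fin (2 * m)))).real (Metric.ball 0 1) = Real.pi ^ m / (m.factorial : ℝ) := by
      rw [Measure.real, InnerProductSpace.volume_ball_of_dim_even (k := m) (by simp)]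
      simp
      positivity
    rw [hv]
    simp only [finrank_euclideanSpace, Fintype.card_fin, nsmul_eq_mul, smul_eq_mul]
    have hi : ∫ y in Set.Ioi (0:ℝ), y ^ (2 * m - 1) * max (1 - y ^ 2 / 2) 0
       = ∫ y in (0:ℝ)..√2, (y ^ (2 * m - 1) - y ^ (2 * m + 1) / 2) := by
      rw [intervalIntegral.integral_of_le (by positivity)]
      rw [← integral_indicator measurableSet_Ioi, ← integral_indicator measurableSet_Ioc]
      congr 1
      ext y
      simp only [Set.indicator, Set.mem_Ioi, Set.mem_Ioc]
      by_cases h0 : 0 < y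
      · by_cases h2 : y ≤ √2
        · have : y ^ 2 ≤ 2 := by
            calc y ^ 2 ≤ √2 ^ 2 := by gcongr
              _ = 2 := by simp
          simp [h0, h2]
          rw [max_eq_left (by linarith)]
          have : 2 * m + 1 = (2 * m - 1) + 2 := by omega
          rw [this, pow_add]; ring
        · have : 2 ≤ y ^ 2 := by
            push Not at h2
            calc 2 = √2 ^ 2 := by simp
              _ ≤ y ^ 2 := by gcongr
          simp [h0, h2]
          right; linarith
      · simp [h0]
    rw [hi, intervalIntegral.integral_sub, intervalIntegral.integral_div, integral_pow, integral_pow]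
    · have e1 : 2 * m - 1 + 1 = 2 * m := by omega
      have e2 : 2 * m + 1 + 1 = 2 * (m + 1) := by omega
      have q1 : √2 ^ (2 * m) = (2:ℝ) ^ m := by rw [pow_mul, Real.sq_sqrt (by norm_num)]
      have q2 : √2 ^ (2 * (m+1)) = (2:ℝ) ^ (m+1) := by rw [pow_mul, Real.sq_sqrt (by norm_num)]
      rw [e1, e2, q1, q2]
      have : ((2 * m - 1 : ℕ) : ℝ) = 2 * m - 1 := by
        rw [Nat.cast_sub (by omega)]; push_cast; ring
      rw [this]
      have hm' : (m : ℝ) ≠ 0 := by positivity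
      have hm'' : (m : ℝ) + 1 ≠ 0 := by positivity
      push_cast
      have h1 : (2 * (m:ℝ) - 1 + 1) = 2 * m := by ring
      have h2 : (2 * (m:ℝ) + 1 + 1) = 2 * (m + 1) := by ring
      rw [h1, h2, zero_pow (by omega), zero_pow (by omega)]
      field_simp
      ring
    · apply Continuous.intervalIntegrable; fun_prop
    · apply Continuous.intervalIntegrable; fun_prop
  · apply Continuous.integrable_of_hasCompactSupport
    · fun_prop
    · apply HasCompactSupport.intro (isCompact_closedBall (0 : EuclideanSpace ℝ (Fin (2 * m))) 2)
      intro x hx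
      simp at hx
      apply max_eq_right
      nlinarith
  · exact Filter.Eventually.of_forall fun _ => le_max_right _ _

lemma blich_point {n : ℕ} {ι : Type*} (s : Finset ι) (v : ι → EuclideanSpace ℝ (Fin n))
    (hv : ∀ i ∈ s, ∀ j ∈ s, i ≠ j → 4 ≤ ‖v i - v j‖ ^ 2) :
    ∑ i ∈ s, (1 - ‖v i‖ ^ 2 / 2) ≤ 1 := by
  classical
  rcases s.eq_empty_or_nonempty with rfl | hne
  · simp
  have h1 : ∑ i ∈ s, ∑ j ∈ s, ‖v i - v j‖ ^ 2 = 2 * s.card * ∑ i ∈ s, ‖v i‖ ^ 2 - 2 * ‖∑ i ∈ s, v i‖ ^ 2 := by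
    simp_rw [norm_sub_sq_real]
    rw [← real_inner_self_eq_norm_sq (∑ i ∈ s, v i), sum_inner]
    simp_rw [inner_sum]
    simp only [Finset.sum_add_distrib, Finset.sum_sub_distrib, Finset.sum_const, nsmul_eq_mul, ← Finset.mul_sum]
    ring
  have h2 : ∑ i ∈ s, ∑ j ∈ s, (if i = j then (0:ℝ) else 4) ≤ ∑ i ∈ s, ∑ j ∈ s, ‖v i - v j‖ ^ 2 := by
    apply Finset.sum_le_sum; intro i hi
    apply Finset.sum_le_sum; intro j hj
    split_ifs with h
    · positivity
    · exact hv i hi j hj h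
  have h3 : ∑ i ∈ s, ∑ j ∈ s, (if i = j then (0:ℝ) else 4) = 4 * s.card * (s.card - 1) := by
    have : ∀ i j : ι, (if i = j then (0:ℝ) else 4) = 4 - (if i = j then 4 else 0) := by
      intro i j; split_ifs <;> norm_num
    simp_rw [this]
    simp only [Finset.sum_sub_distrib, Finset.sum_const, nsmul_eq_mul, Finset.sum_ite_eq]
    rw [Finset.sum_congr rfl (fun x hx => if_pos hx)]
    simp; ring
  have hc : (0:ℝ) < s.card := by exact_mod_cast hne.card_pos
  have h4 : (s.card : ℝ) * (2 * (s.card - 1)) ≤ s.card * ∑ i ∈ s, ‖v i‖ ^ 2 := by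
    have := sq_nonneg ‖∑ i ∈ s, v i‖
    nlinarith
  have h5 := le_of_mul_le_mul_left h4 hc
  rw [Finset.sum_sub_distrib, ← Finset.sum_div]
  simp
  linarith

open MeasureTheory in
lemma blich (m : ℕ) (hm : 0 < m) (B : Matrix (Fin (2 * m)) (Fin (2 * m)) ℝ) (hB : B.det ≠ 0)
    (h4 : ∀ z : Fin (2 * m) → ℤ, z ≠ 0 → 4 ≤ ‖WithLp.toLp 2 (B *ᵥ (fun i => (z i : ℝ)))‖ ^ 2) :
    Real.pi ^ m / (m.factorial : ℝ) * (2 ^ m / (m + 1)) ≤ |B.det| := by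
  let h : (Fin (2 * m) → ℝ) → ENNReal := fun y => ENNReal.ofReal (1 - ‖WithLp.toLp 2 y‖ ^ 2 / 2)
  have hmeas : Measurable h := by
    apply Measurable.ennreal_ofReal
    apply Continuous.measurable
    have := (PiLp.continuous_toLp 2 (fun _ : Fin (2*m) => ℝ))
    fun_prop
  have e1 : ∫⁻ y, h y = ENNReal.ofReal (Real.pi ^ m / (m.factorial : ℝ) * (2 ^ m / (m + 1))) := by
    rw [← sigma_int m hm]
    exact (PiLp.volume_preserving_toLp (Fin (2 * m))).lintegral_comp (f := fun y => ENNReal.ofReal (1 - ‖y‖ ^ 2 / 2)) (by fun_prop)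
  have e2 : ∫⁻ x, h (B *ᵥ x) = ENNReal.ofReal |B.det⁻¹| * ∫⁻ y, h y := by
    have := Real.map_matrix_volume_pi_eq_smul_volume_pi hB
    have h2 : ∫⁻ y, h y ∂(Measure.map (Matrix.toLin' B) volume) = ∫⁻ x, h (Matrix.toLin' B x) :=
      lintegral_map hmeas (LinearMap.continuous_of_finiteDimensional _).measurable
    rw [this, lintegral_smul_measure] at h2
    simp only [Matrix.toLin'_apply] at h2
    rw [← h2]; rfl
  let b := Pi.basisFun ℝ (Fin (2 * m))
  have hF := ZSpan.isAddFundamentalDomain' b volume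
  have e3 : ∫⁻ x, h (B *ᵥ x) ≤ 1 := by
    have hvol : volume (ZSpan.fundamentalDomain b) = 1 := by
      have : Matrix.of (Pi.basisFun ℝ (Fin (2 * m))) = 1 := by
        ext i j; simp [Matrix.one_apply, Pi.single_apply, eq_comm]
      simp [b, this]
    haveI : Countable (Submodule.span ℤ (Set.range b)).toAddSubgroup :=
      inferInstanceAs (Countable (Submodule.span ℤ (Set.range b)))
    rw [hF.lintegral_eq_tsum' (fun x => h (B *ᵥ x)), ← lintegral_tsum]
    · calc _ ≤ ∫⁻ x in ZSpan.fundamentalDomain b, 1 := by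
            apply lintegral_mono
            intro x
            dsimp only
            rw [ENNReal.tsum_eq_iSup_sum]
            apply iSup_le
            intro s
            classical
            let v : (Submodule.span ℤ (Set.range b)).toAddSubgroup → EuclideanSpace ℝ (Fin (2*m)) := fun g => WithLp.toLp 2 (B *ᵥ (-g +ᵥ x))
            have hs : ∑ g ∈ s, h (B *ᵥ (-g +ᵥ x)) = ∑ g ∈ s with 0 < (1 - ‖v g‖ ^ 2 / 2), ENNReal.ofReal (1 - ‖v g‖ ^ 2 / 2) := by
              rw [Finset.sum_filter]
              apply Finset.sum_congr rfl
              intro g _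
              split_ifs with hh
              · rfl
              · exact ENNReal.ofReal_of_nonpos (not_lt.1 hh)
            rw [hs, ← ENNReal.ofReal_sum_of_nonneg (fun g hg => (Finset.mem_filter.1 hg).2.le)]
            rw [ENNReal.ofReal_le_one]
            apply blich_point
            intro i _ j _ hij
            have hz : ∃ z : Fin (2 * m) → ℤ, (fun k => (z k : ℝ)) = (j : Fin (2 * m) → ℝ) - i := by
              have : ((j - i : (Submodule.span ℤ (Set.range b)).toAddSubgroup) : Fin (2 * m) → ℝ) ∈ Submodule.span ℤ (Set.range b) := (j - i).2
              rw [b.mem_span_iff_repr_mem ℤ] at this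
              choose z hz using this
              refine ⟨z, ?_⟩
              ext k
              have := hz k
              simpa [b] using this
            obtain ⟨z, hz⟩ := hz
            have hz0 : z ≠ 0 := by
              rintro rfl
              apply hij
              have : (j : Fin (2 * m) → ℝ) - i = 0 := by rw [← hz]; ext; simp
              exact Subtype.ext (sub_eq_zero.1 this).symm
            have := h4 z hz0
            rw [hz] at this
            have e : v i - v j = WithLp.toLp 2 (B *ᵥ ((j : Fin (2 * m) → ℝ) - i)) := by
              simp only [v]
              rw [← WithLp.toLp_sub, ← Matrix.mulVec_sub]
              congr 2
              simp [AddSubgroup.vadd_def]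
              abel
            rw [e]; exact this
        _ = 1 := by simp [hvol]
    · intro g
      apply Measurable.aemeasurable
      apply hmeas.comp
      apply Continuous.measurable
      simp only [AddSubgroup.vadd_def]
      fun_prop
  rw [e2, e1, ← ENNReal.ofReal_mul (abs_nonneg _), ENNReal.ofReal_le_one, abs_inv] at e3
  have : 0 < |B.det| := abs_pos.2 hB
  rwa [inv_mul_le_one₀ this] at e3


open scoped MatrixOrder in
lemma gram_bound (m : ℕ) (hm : 0 < m) (G : Matrix (Fin (2 * m)) (Fin (2 * m)) ℤ) (hs : G.IsSymm)
    (h4 : ∀ z, z ≠ 0 → 4 ≤ z ⬝ᵥ G *ᵥ z) :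
    (Real.pi ^ m / (m.factorial : ℝ) * (2 ^ m / (m + 1))) ^ 2 ≤ |(G.det : ℝ)| := by
  set R : Matrix (Fin (2 * m)) (Fin (2 * m)) ℝ := G.map (Int.cast) with hR
  have hZ : ∀ z : Fin (2 * m) → ℤ, (fun i => (z i : ℝ)) ⬝ᵥ R *ᵥ (fun i => (z i : ℝ)) = ((z ⬝ᵥ G *ᵥ z : ℤ) : ℝ) := by
    intro z
    simp [R, Matrix.mulVec, dotProduct]
  have hdet : R.det = (G.det : ℝ) := by
    have := (Int.castRingHom ℝ).map_det G
    simpa [R] using this.symm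
  have hdet0 : R.det ≠ 0 := by
    rw [hdet]
    intro h0
    have h0 : G.det = 0 := by exact_mod_cast h0
    obtain ⟨v, hv, hv0⟩ := Matrix.exists_mulVec_eq_zero_iff.2 h0
    have := h4 v hv
    rw [hv0] at this
    simp at this
  have hpsd : R.PosSemidef := by
    refine Matrix.PosSemidef.of_dotProduct_mulVec_nonneg ?_ ?_
    · rw [Matrix.IsHermitian, Matrix.conjTranspose_eq_transpose_of_trivial, hR, ← Matrix.transpose_map, hs.eq]
    · intro x
      simp only [star_trivial]
      have hd : DenseRange (Pi.map (fun (_ : Fin (2 * m)) (q : ℚ) => (q : ℝ))) :=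
        DenseRange.piMap (fun _ => Rat.denseRange_cast)
      refine hd.induction_on (p := fun x => 0 ≤ x ⬝ᵥ R *ᵥ x) x ?_ ?_
      · apply isClosed_le continuous_const
        fun_prop
      · intro q
        obtain ⟨⟨d, hd0⟩, hd⟩ := IsLocalization.exist_integer_multiples_of_finite (nonZeroDivisors ℤ) q
        choose z hz using hd
        have hd0' : (d : ℝ) ≠ 0 := by
          have := nonZeroDivisors.ne_zero hd0
          exact_mod_cast this
        have hz' : (fun i => (z i : ℝ)) = (d : ℝ) • (Pi.map (fun (_ : Fin (2 * m)) (q : ℚ) => (q : ℝ)) q) := by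
          ext i
          have := hz i
          simp at this
          simp
          exact_mod_cast this
        have h1 := hZ z
        have h2 : 0 ≤ z ⬝ᵥ G *ᵥ z := by
          by_cases hz0 : z = 0
          · simp [hz0]
          · have := h4 z hz0; omega
        rw [hz', Matrix.mulVec_smul, smul_dotProduct, dotProduct_smul, smul_eq_mul, smul_eq_mul, ← mul_assoc] at h1
        have h3 : (0:ℝ) ≤ ((z ⬝ᵥ G *ᵥ z : ℤ) : ℝ) := by exact_mod_cast h2
        rw [← h1] at h3
        exact nonneg_of_mul_nonneg_right h3 (mul_self_pos.2 hd0')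
  have hn : 0 ≤ R := Matrix.nonneg_iff_posSemidef.2 hpsd
  set B := CFC.sqrt R with hBdef
  have hBB : B * B = R := CFC.sqrt_mul_sqrt_self R hn
  have hBs : Bᵀ = B := by
    have : B.PosSemidef := Matrix.nonneg_iff_posSemidef.1 (CFC.sqrt_nonneg R)
    have := this.isHermitian
    rwa [Matrix.IsHermitian, Matrix.conjTranspose_eq_transpose_of_trivial] at this
  have hBd : B.det * B.det = R.det := by rw [← Matrix.det_mul, hBB]
  have hB0 : B.det ≠ 0 := by
    intro h; rw [h] at hBd; simp at hBd; exact hdet0 hBd.symm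
  have := blich m hm B hB0 (by
    intro z hz
    rw [EuclideanSpace.real_norm_sq_eq]
    have e : ∑ i, (WithLp.toLp 2 (B *ᵥ (fun i => (z i : ℝ)))).ofLp i ^ 2 = ((z ⬝ᵥ G *ᵥ z : ℤ) : ℝ) := by
      rw [← hZ, ← hBB, ← Matrix.mulVec_mulVec, Matrix.dotProduct_mulVec, ← Matrix.mulVec_transpose, hBs]
      simp [dotProduct, sq]
    rw [e]
    exact_mod_cast h4 z hz)
  rw [← hdet, ← hBd, abs_mul, ← sq]
  exact pow_le_pow_left₀ (by positivity) this 2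

lemma gram_bound4 (G : Matrix (Fin 4) (Fin 4) ℤ) (hs : G.IsSymm)
    (h4 : ∀ z, z ≠ 0 → 4 ≤ z ⬝ᵥ G *ᵥ z) : 5 < |G.det| := by
  have := gram_bound 2 (by norm_num) G hs h4
  have hpi := Real.pi_gt_three
  have h2 : (3:ℝ) ^ 2 ≤ Real.pi ^ 2 := pow_le_pow_left₀ (by norm_num) hpi.le 2
  norm_num [Nat.factorial] at this
  have h3 : (5 : ℝ) < |(G.det : ℝ)| := by nlinarith
  exact_mod_cast h3

lemma gram_bound8 (G : Matrix (Fin 8) (Fin 8) ℤ) (hs : G.IsSymm)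
    (h4 : ∀ z, z ≠ 0 → 4 ≤ z ⬝ᵥ G *ᵥ z) : 25 < |G.det| := by
  have := gram_bound 4 (by norm_num) G hs h4
  have hpi := Real.pi_gt_three
  have h2 : (3:ℝ) ^ 4 ≤ Real.pi ^ 4 := pow_le_pow_left₀ (by norm_num) hpi.le 4
  norm_num [Nat.factorial] at this
  have h3 : (25 : ℝ) < |(G.det : ℝ)| := by nlinarith
  exact_mod_cast h3

lemma gram_bound12 (G : Matrix (Fin 12) (Fin 12) ℤ) (hs : G.IsSymm)
    (h4 : ∀ z, z ≠ 0 → 4 ≤ z ⬝ᵥ G *ᵥ z) : 125 < |G.det| := by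
  have := gram_bound 6 (by norm_num) G hs h4
  have hpi := Real.pi_gt_d2
  have h2 : (3.14:ℝ) ^ 6 ≤ Real.pi ^ 6 := pow_le_pow_left₀ (by norm_num) hpi.le 6
  norm_num [Nat.factorial] at this h2
  have h3 : (125 : ℝ) < |(G.det : ℝ)| := by nlinarith
  exact_mod_cast h3


lemma ext_ker {M : Type*} [AddCommGroup M] [Module.Free ℤ M] [Module.Finite ℤ M]
    (f : Module.End ℤ M) (g : LinearMap.ker f →ₗ[ℤ] ℤ) :
    ∃ g' : M →ₗ[ℤ] ℤ, ∀ x : LinearMap.ker f, g' x = g x := by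
  obtain ⟨h, hh⟩ := Module.projective_lifting_property f.rangeRestrict LinearMap.id
    f.surjective_rangeRestrict
  have hmem : ∀ x : M, (LinearMap.id - h ∘ₗ f.rangeRestrict : M →ₗ[ℤ] M) x ∈ LinearMap.ker f := by
    intro x
    have := congrArg Subtype.val (LinearMap.congr_fun hh (f.rangeRestrict x))
    simp at this
    simp [this]
  refine ⟨g ∘ₗ LinearMap.codRestrict _ _ hmem, ?_⟩
  intro x
  have hx : f.rangeRestrict (x : M) = 0 := by
    apply Subtype.ext
    simp
  simp only [LinearMap.comp_apply]
  congr 1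
  apply Subtype.ext
  simp [hx]

lemma det_five {S : Type*} [AddCommGroup S] [Module.Free ℤ S] [Module.Finite ℤ S]
    (w : Module.End ℤ S) (h : 1 + w + w ^ 2 + w ^ 3 + w ^ 4 = 0) :
    ∃ k : ℕ, finrank ℤ S = 4 * k ∧ (LinearMap.det (1 - w)).natAbs = 5 ^ k := by
  have h4 : w ^ 4 = - (1 + w + w ^ 2 + w ^ 3) := by
    rw [eq_neg_iff_add_eq_zero, ← h]; abel
  have h5 : w ^ 5 = 1 := by
    have : w ^ 5 = w ^ 4 * w := by rw [← pow_succ]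
    have e : -(1 + w + w ^ 2 + w ^ 3) * w = -w - w ^ 2 - w ^ 3 - w ^ 4 := by noncomm_ring
    rw [this, h4, e, h4]; abel
  have e1 : (1 - w) ^ 4 = (-5 : ℤ) • (w - w ^ 2 + w ^ 3) := by
    have : (1 - w) ^ 4 = 1 - 4 • w + 6 • w ^ 2 - 4 • w ^ 3 + w ^ 4 := by noncomm_ring
    rw [this, h4]; module
  have e2 : (w - w ^ 2 + w ^ 3) * (- w ^ 4 - w ^ 2 - (2:ℤ) • w ^ 3) = 1 := by
    have : (w - w ^ 2 + w ^ 3) * (- w ^ 4 - w ^ 2 - (2:ℤ) • w ^ 3)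
      = - w ^ 3 - w ^ 4 - w ^ 5 * w - w ^ 5 * w ^ 2 := by noncomm_ring
    rw [this, h5, h4]; noncomm_ring
  have d1 := congrArg LinearMap.det e1
  have d2 := congrArg LinearMap.det e2
  rw [map_pow, LinearMap.det_smul] at d1
  rw [map_mul, map_one] at d2
  have hu : (LinearMap.det (w - w ^ 2 + w ^ 3)).natAbs = 1 :=
    Int.natAbs_of_isUnit (IsUnit.of_mul_eq_one _ d2)
  have d3 := congrArg Int.natAbs d1
  rw [Int.natAbs_pow, Int.natAbs_mul, hu, Int.natAbs_pow, mul_one] at d3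
  have d3 : (LinearMap.det (1 - w)).natAbs ^ 4 = 5 ^ finrank ℤ S := d3
  obtain ⟨k, _, hk⟩ := (Nat.dvd_prime_pow Nat.prime_five).1
    (d3 ▸ dvd_pow_self _ (by norm_num) : (LinearMap.det (1 - w)).natAbs ∣ 5 ^ finrank ℤ S)
  refine ⟨k, ?_, hk⟩
  rw [hk, ← pow_mul] at d3
  have := Nat.pow_right_injective (le_refl 2 |>.trans (by norm_num : 2 ≤ 5)) d3
  omega

section core
variable {Λ : Type*} [AddCommGroup Λ] [Module.Free ℤ Λ] [Module.Finite ℤ Λ]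

/-- The norm element. -/
def nrm (f : Module.End ℤ Λ) : Module.End ℤ Λ := 1 + f + f ^ 2 + f ^ 3 + f ^ 4

lemma nrm_apply (f : Module.End ℤ Λ) (x : Λ) :
    nrm f x = x + f x + f (f x) + f (f (f x)) + f (f (f (f x))) := by
  simp [nrm, pow_succ]

/-- f minus identity. -/
def fsub (f : Module.End ℤ Λ) : Module.End ℤ Λ := f - LinearMap.id

lemma fsub_apply (f : Module.End ℤ Λ) (x : Λ) : fsub f x = f x - x := rfl

/-- Dual vectors for a basis of a kernel. -/
lemma dual_vecs (b : Λ →ₗ[ℤ] Λ →ₗ[ℤ] ℤ) (hu : Function.Bijective b) (f : Module.End ℤ Λ) {n : ℕ}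
    (s : Basis (Fin n) ℤ (LinearMap.ker f)) :
    ∃ l : Fin n → Λ, ∀ i (x : LinearMap.ker f), b (l i) x = s.repr x i := by
  have : ∀ i, ∃ l : Λ, ∀ x : LinearMap.ker f, b l x = s.repr x i := by
    intro i
    obtain ⟨g, hg⟩ := ext_ker f (s.coord i)
    obtain ⟨l, rfl⟩ := hu.2 g
    exact ⟨l, fun x => by rw [hg]; rfl⟩
  choose l hl using this
  exact ⟨l, hl⟩

/-- Negative Gram matrix of a family. -/
def ngram (b : Λ →ₗ[ℤ] Λ →ₗ[ℤ] ℤ) {n : ℕ} (s : Fin n → Λ) : Matrix (Fin n) (Fin n) ℤ :=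
  Matrix.of fun i j => - b (s i) (s j)

lemma ngram_quad (b : Λ →ₗ[ℤ] Λ →ₗ[ℤ] ℤ) {n : ℕ} (s : Fin n → Λ) (x y : Fin n → ℤ) :
    x ⬝ᵥ ngram b s *ᵥ y = - b (∑ i, x i • s i) (∑ i, y i • s i) := by
  simp only [ngram, map_sum, map_smul, LinearMap.sum_apply, LinearMap.smul_apply, dotProduct,
    Matrix.mulVec, Matrix.of_apply, smul_eq_mul, Finset.mul_sum, ← Finset.sum_neg_distrib]
  rw [Finset.sum_comm]
  refine Finset.sum_congr rfl fun i _ => Finset.sum_congr rfl fun j _ => ?_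
  ring

lemma ngram_symm (b : Λ →ₗ[ℤ] Λ →ₗ[ℤ] ℤ) (hsymm : ∀ x y, b x y = b y x) {n : ℕ} (s : Fin n → Λ) :
    (ngram b s).IsSymm := by
  ext i j; simp [ngram, hsymm (s j)]

lemma ngram_min (b : Λ →ₗ[ℤ] Λ →ₗ[ℤ] ℤ) (heven : ∀ x, Even (b x x))
    (hneg : ∀ x, x ≠ 0 → b x x < 0) (hnoroot : ∀ x, b x x ≠ -2) {n : ℕ} (s : Fin n → Λ)
    (hs : LinearIndependent ℤ s) (x : Fin n → ℤ) (hx : x ≠ 0) : 4 ≤ x ⬝ᵥ ngram b s *ᵥ x := by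
  rw [ngram_quad]
  have h0 : ∑ i, x i • s i ≠ 0 := by
    intro h
    apply hx
    ext i
    exact Fintype.linearIndependent_iff.1 hs x h i
  have h1 := hneg _ h0
  have h2 := hnoroot (∑ i, x i • s i)
  obtain ⟨r, hr⟩ := heven (∑ i, x i • s i)
  omega

variable (b : Λ →ₗ[ℤ] Λ →ₗ[ℤ] ℤ) (hsymm : ∀ x y : Λ, b x y = b y x)
    (heven : ∀ x : Λ, Even (b x x)) (hneg : ∀ x : Λ, x ≠ 0 → b x x < 0)
    (hu : Function.Bijective b) (hnoroot : ∀ x : Λ, b x x ≠ -2)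
    (f : Module.End ℤ Λ) (hiso : ∀ x y : Λ, b (f x) (f y) = b x y)
    (h5 : ∀ x, f (f (f (f (f x)))) = x)

include h5 in
lemma nrm_sub (x : Λ) : nrm f (x - f x) = 0 := by
  rw [nrm_apply]; simp only [map_sub, h5]; abel

include h5 in
lemma f_nrm (x : Λ) : f (nrm f x) = nrm f x := by
  rw [nrm_apply]; simp only [map_add, h5]; abel

include b hu hiso h5 in
lemma coinv_det (n : ℕ) (s : Basis (Fin n) ℤ (LinearMap.ker (nrm f))) :
    ∃ k : ℕ, n = 4 * k ∧ |(ngram b (fun i => (s i : Λ))).det| ≤ 5 ^ k := by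
  obtain ⟨l, hl⟩ := dual_vecs b hu (nrm f) s
  have hmem : ∀ x ∈ LinearMap.ker (nrm f), (f ^ 4) x ∈ LinearMap.ker (nrm f) := by
    intro x hx
    rw [LinearMap.mem_ker] at hx ⊢
    have : nrm f ((f ^ 4) x) = (f ^ 4) (nrm f x) := by
      simp [nrm_apply, pow_succ]
    rw [this, hx, map_zero]
  let w : Module.End ℤ (LinearMap.ker (nrm f)) := (f ^ 4).restrict hmem
  have hw : ∀ x, ((w x : LinearMap.ker (nrm f)) : Λ) = f (f (f (f x))) := by
    intro x; simp [w, pow_succ]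
  have hw0 : 1 + w + w ^ 2 + w ^ 3 + w ^ 4 = 0 := by
    ext x
    have hx := x.2
    rw [LinearMap.mem_ker, nrm_apply] at hx
    simp only [LinearMap.add_apply, Module.End.one_apply, pow_succ, pow_zero, one_mul, Module.End.mul_apply,
      Submodule.coe_add, hw, h5, LinearMap.zero_apply, Submodule.coe_zero]
    rw [← hx]; abel
  obtain ⟨k, hk, hkd⟩ := det_five w hw0
  have hn : n = 4 * k := by
    rw [← hk, finrank_eq_card_basis s, Fintype.card_fin]
  refine ⟨k, hn, ?_⟩
  let p : Fin n → LinearMap.ker (nrm f) := fun i => ⟨l i - f (l i), nrm_sub f h5 _⟩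
  let A : Matrix (Fin n) (Fin n) ℤ := Matrix.of fun i j => s.repr (p i) j
  have hA : A * ngram b (fun i => (s i : Λ)) = - LinearMap.toMatrix s s (1 - w) := by
    ext i k
    have h1 : b (p i : Λ) (s k : Λ) = ∑ j, A i j * b (s j : Λ) (s k) := by
      have e : (p i : Λ) = ∑ j, s.repr (p i) j • (s j : Λ) := by
        have := congrArg Subtype.val (s.sum_repr (p i)).symm
        rw [this]; simp only [Submodule.coe_sum, Submodule.coe_smul]
      rw [e]; simp only [map_sum, map_smul, LinearMap.sum_apply, LinearMap.smul_apply, smul_eq_mul]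
      rfl
    have hf : ∀ x y : Λ, b (f x) y = b x (f (f (f (f y)))) := by
      intro x y
      rw [← hiso x, h5]
    have h2 : b (p i : Λ) (s k : Λ) = s.repr ((1 - w) (s k)) i := by
      rw [← hl i]
      simp [p, hf, hw]
    rw [Matrix.mul_apply, Matrix.neg_apply, LinearMap.toMatrix_apply, ← h2, h1, ← Finset.sum_neg_distrib]
    simp [ngram]
  have hd := congrArg Int.natAbs (congrArg Matrix.det hA)
  rw [Matrix.det_mul, Matrix.det_neg, LinearMap.det_toMatrix, Int.natAbs_mul, Int.natAbs_mul, hkd] at hd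
  simp [Int.natAbs_pow] at hd
  have : (ngram b (fun i => (s i : Λ))).det.natAbs ≤ 5 ^ k := by
    apply Nat.le_of_dvd (by positivity)
    rw [← hd]; exact dvd_mul_left _ _
  rw [Int.abs_eq_natAbs]
  exact_mod_cast this

include h5 in
lemma rank_add : finrank ℤ (LinearMap.ker (fsub f)) + finrank ℤ (LinearMap.ker (nrm f)) = finrank ℤ Λ := by
  have h0 := Submodule.finrank_quotient_add_finrank (LinearMap.ker (nrm f))
  rw [LinearEquiv.finrank_eq (LinearMap.quotKerEquivRange (nrm f))] at h0
  suffices h : finrank ℤ (LinearMap.ker (fsub f)) = finrank ℤ (LinearMap.range (nrm f)) by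
    rw [h]; exact h0
  apply le_antisymm
  · have hm : ∀ x : LinearMap.ker (fsub f), nrm f x = (5:ℤ) • (x : Λ) := by
      intro x
      have hx := x.2
      rw [LinearMap.mem_ker, fsub_apply] at hx
      have hx : f (x : Λ) = x := sub_eq_zero.1 hx
      rw [nrm_apply]; simp only [hx]; module
    apply LinearMap.finrank_le_finrank_of_injective (f := ((nrm f).rangeRestrict ∘ₗ (LinearMap.ker (fsub f)).subtype))
    intro x y hxy
    have := congrArg Subtype.val hxy
    simp [hm] at this
    exact this
  · apply Submodule.finrank_mono
    rintro _ ⟨x, rfl⟩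
    rw [LinearMap.mem_ker, fsub_apply, f_nrm f h5, sub_self]

include b hsymm heven hneg hu hnoroot hiso h5 in
lemma coinv_rank (hr : finrank ℤ Λ = 24) (hne : ∃ x, f x ≠ x) :
    finrank ℤ (LinearMap.ker (nrm f)) = 16 ∨ finrank ℤ (LinearMap.ker (nrm f)) = 20 ∨
      finrank ℤ (LinearMap.ker (nrm f)) = 24 := by
  have hle := rank_add f h5
  have hmin : ∀ (n : ℕ) (s : Basis (Fin n) ℤ (LinearMap.ker (nrm f))) (z : Fin n → ℤ), z ≠ 0 →
      4 ≤ z ⬝ᵥ ngram b (fun i => (s i : Λ)) *ᵥ z := by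
    intro n s
    apply ngram_min b heven hneg hnoroot
    exact s.linearIndependent.map' (LinearMap.ker (nrm f)).subtype (by simp)
  obtain ⟨k, hk, hkd⟩ := coinv_det b hu f hiso h5 _ (finBasis ℤ (LinearMap.ker (nrm f)))
  have hk7 : k < 7 := by omega
  have key : ∀ n, finrank ℤ (LinearMap.ker (nrm f)) = n →
      ∃ G : Matrix (Fin n) (Fin n) ℤ, G.IsSymm ∧ (∀ z, z ≠ 0 → 4 ≤ z ⬝ᵥ G *ᵥ z) ∧ |G.det| ≤ 5 ^ k := by
    rintro n rfl
    exact ⟨_, ngram_symm b hsymm _, hmin _ _, hkd⟩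
  interval_cases k
  · exfalso
    obtain ⟨x, hx⟩ := hne
    have h0 : LinearMap.ker (nrm f) = ⊥ := Submodule.finrank_eq_zero.1 hk
    have : x - f x ∈ LinearMap.ker (nrm f) := nrm_sub f h5 x
    rw [h0, Submodule.mem_bot, sub_eq_zero] at this
    exact hx this.symm
  · exfalso
    obtain ⟨G, h1, h2, h3⟩ := key 4 (by omega)
    have := gram_bound4 G h1 h2
    omega
  · exfalso
    obtain ⟨G, h1, h2, h3⟩ := key 8 (by omega)
    have := gram_bound8 G h1 h2
    omega
  · exfalso
    obtain ⟨G, h1, h2, h3⟩ := key 12 (by omega)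
    have := gram_bound12 G h1 h2
    omega
  all_goals omega

include b hsymm heven hneg hu hnoroot hiso h5 in
lemma inv_lattice (hr : finrank ℤ (LinearMap.ker (fsub f)) = 4) :
    ∃ e : LinearMap.ker (fsub f) ≃ₗ[ℤ] (Fin 4 → ℤ),
      ∀ x y : LinearMap.ker (fsub f), b (x : Λ) (y : Λ) =
        (e x) ⬝ᵥ ((!![-4,-1,-1,1; -1,-4,1,-1; -1,1,-4,-1; 1,-1,-1,-4] : Matrix (Fin 4) (Fin 4) ℤ) *ᵥ (e y)) := by
  let t : Basis (Fin 4) ℤ (LinearMap.ker (fsub f)) := finBasisOfFinrankEq ℤ _ hr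
  obtain ⟨l, hl⟩ := dual_vecs b hu (fsub f) t
  let p : Fin 4 → LinearMap.ker (fsub f) := fun i => ⟨nrm f (l i), by
    rw [LinearMap.mem_ker, fsub_apply, f_nrm f h5, sub_self]⟩
  let A : Matrix (Fin 4) (Fin 4) ℤ := Matrix.of fun i j => - t.repr (p i) j
  let tv : Fin 4 → Λ := fun i => (t i : Λ)
  have htv : LinearIndependent ℤ tv := t.linearIndependent.map' (LinearMap.ker (fsub f)).subtype (by simp)
  set G := ngram b tv with hG
  have hGs : G.IsSymm := ngram_symm b hsymm _
  have hG4 : ∀ x, x ≠ 0 → 4 ≤ x ⬝ᵥ G *ᵥ x := ngram_min b heven hneg hnoroot _ htv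
  have hfx : ∀ x : LinearMap.ker (fsub f), f (x : Λ) = x := by
    intro x
    have hx := x.2
    rw [LinearMap.mem_ker, fsub_apply] at hx
    exact sub_eq_zero.1 hx
  have hnb : ∀ (x : Λ) (y : LinearMap.ker (fsub f)), b (nrm f x) y = 5 * b x y := by
    intro x y
    have h1 : ∀ z : Λ, b (f z) y = b z y := by
      intro z
      have := hiso z y
      rwa [hfx] at this
    rw [nrm_apply]
    simp only [map_add, LinearMap.add_apply, h1]; ring
  have hAG : A * G = 5 := by
    ext i k
    have h1 : b (p i : Λ) (t k : Λ) = ∑ j, t.repr (p i) j * b (t j : Λ) (t k) := by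
      have e : (p i : Λ) = ∑ j, t.repr (p i) j • (t j : Λ) := by
        have := congrArg Subtype.val (t.sum_repr (p i)).symm
        rw [this]; simp only [Submodule.coe_sum, Submodule.coe_smul]
      rw [e]; simp only [map_sum, map_smul, LinearMap.sum_apply, LinearMap.smul_apply, smul_eq_mul]
    have h2 : b (p i : Λ) (t k : Λ) = 5 * t.repr (t k) i := by
      rw [← hl i]
      exact hnb _ _
    rw [five_eq, Matrix.mul_apply]
    simp only [A, hG, ngram, Matrix.of_apply, neg_mul_neg, tv]
    rw [← h1, h2]
    simp [Matrix.one_apply, Finsupp.single_apply, eq_comm]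
  have hGA : G * A = 5 := by
    have h0 : A * G * A = 5 * A := by rw [hAG]
    have hdA : A.det ≠ 0 := by
      intro h
      have := congrArg Matrix.det hAG
      rw [Matrix.det_mul, h, five_eq, Matrix.det_smul] at this
      simp at this
    have h1 : A * (G * A - 5) = 0 := by
      rw [Matrix.mul_sub, ← Matrix.mul_assoc, h0, show A * 5 = 5 * A from (Commute.ofNat_right A 5).eq, sub_self]
    have h2 : A.adjugate * (A * (G * A - 5)) = 0 := by rw [h1, Matrix.mul_zero]
    rw [← Matrix.mul_assoc, Matrix.adjugate_mul, smul_mul_assoc, Matrix.one_mul] at h2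
    exact sub_eq_zero.1 ((smul_eq_zero.1 h2).resolve_left hdA)
  have hAs : A.IsSymm := by
    have h1 : G * Aᵀ = 5 := by
      have := congrArg Matrix.transpose hAG
      rw [Matrix.transpose_mul, hGs.eq] at this
      rw [this, five_eq]; simp
    have h2 : A * (G * Aᵀ) = A * (G * A) := by rw [h1, hGA]
    rw [← Matrix.mul_assoc, ← Matrix.mul_assoc, hAG, five_eq, smul_mul_assoc, smul_mul_assoc, Matrix.one_mul, Matrix.one_mul] at h2
    exact smul_right_injective _ (by norm_num : (5:ℤ) ≠ 0) h2
  have h5A : ∀ x : Fin 4 → ℤ, 5 * (x ⬝ᵥ A *ᵥ x) = (A *ᵥ x) ⬝ᵥ G *ᵥ (A *ᵥ x) := by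
    intro x
    have e : (A *ᵥ x) ⬝ᵥ G *ᵥ (A *ᵥ x) = x ⬝ᵥ (A * (G * A)) *ᵥ x := by
      have hxA : A *ᵥ x = x ᵥ* A := by rw [← Matrix.mulVec_transpose, hAs.eq]
      calc (A *ᵥ x) ⬝ᵥ G *ᵥ (A *ᵥ x) = (x ᵥ* A) ⬝ᵥ G *ᵥ (A *ᵥ x) := by rw [← hxA]
        _ = _ := by
          rw [← Matrix.dotProduct_mulVec]
          simp only [Matrix.mulVec_mulVec, Matrix.mul_assoc]
    rw [e, hGA, five_eq, Matrix.mul_smul, Matrix.mul_one, Matrix.smul_mulVec, dotProduct_smul, smul_eq_mul]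
  have hAne : ∀ x : Fin 4 → ℤ, x ≠ 0 → A *ᵥ x ≠ 0 := by
    intro x hx h0
    apply hx
    have := congrArg (fun v => G *ᵥ v) h0
    simp only [Matrix.mulVec_mulVec, hGA, five_eq, Matrix.smul_mulVec, Matrix.one_mulVec, Matrix.mulVec_zero] at this
    exact (smul_eq_zero.1 this).resolve_left (by norm_num)
  have hAe : ∀ x : Fin 4 → ℤ, Even (x ⬝ᵥ A *ᵥ x) := by
    intro x
    have h1 := h5A x
    rw [hG, ngram_quad] at h1
    obtain ⟨r, hr⟩ := heven (∑ i, (A *ᵥ x) i • tv i)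
    rw [Int.even_iff]
    omega
  obtain ⟨U, hU, hUG⟩ := rank4_final G A ⟨hGs, fun x hx => by linarith [hG4 x hx]⟩ hG4
    ⟨hAs, fun x hx => by
      have := hG4 _ (hAne x hx)
      have := h5A x
      omega⟩ hAe hAG
  -- coordinates: x = ∑ (repr x) t, e x = (Uᵀ)⁻¹ repr x
  have hUt : IsUnit (Uᵀ).det := by rwa [Matrix.det_transpose]
  let e0 : (Fin 4 → ℤ) ≃ₗ[ℤ] (Fin 4 → ℤ) := Matrix.toLinearEquiv' Uᵀ ((Matrix.isUnit_iff_isUnit_det _).2 hUt).invertible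
  have he0 : ∀ x, e0 x = Uᵀ *ᵥ x := fun x => rfl
  refine ⟨t.equivFun.trans e0.symm, ?_⟩
  intro x y
  have hc : ∀ x : LinearMap.ker (fsub f), ∃ u, (t.equivFun.trans e0.symm) x = u ∧ (x : Λ) = ∑ i, (Uᵀ *ᵥ u) i • tv i := by
    intro x
    refine ⟨_, rfl, ?_⟩
    rw [← he0]
    simp only [LinearEquiv.trans_apply, LinearEquiv.apply_symm_apply]
    have := congrArg Subtype.val (t.sum_equivFun x).symm
    rw [this]; simp only [Submodule.coe_sum, Submodule.coe_smul, tv]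
  obtain ⟨u, hu1, hu2⟩ := hc x
  obtain ⟨v, hv1, hv2⟩ := hc y
  rw [hu1, hv1, hu2, hv2]
  have h1 := ngram_quad b tv (Uᵀ *ᵥ u) (Uᵀ *ᵥ v)
  have h2 : (Uᵀ *ᵥ u) ⬝ᵥ G *ᵥ (Uᵀ *ᵥ v) = u ⬝ᵥ (U * G * Uᵀ) *ᵥ v := by
    rw [Matrix.mulVec_transpose, ← Matrix.dotProduct_mulVec]
    simp only [Matrix.mulVec_mulVec, Matrix.mul_assoc]
  rw [← hG, h2, hUG] at h1
  have h3 : (!![-4,-1,-1,1; -1,-4,1,-1; -1,1,-4,-1; 1,-1,-1,-4] : Matrix (Fin 4) (Fin 4) ℤ)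
    = - !![4,1,1,-1; 1,4,-1,1; 1,-1,4,1; -1,1,1,4] := by decide
  rw [h3, Matrix.neg_mulVec, dotProduct_neg, h1, neg_neg]

end core

/-- the coinvariant lattice of an order-5 isometry of the Leech lattice
has rank 16, 20 or 24; in the rank 20 case the invariant lattice is isometric to the
stated rank-4 lattice, and in the rank 24 case the coinvariant lattice is the whole
Leech lattice. -/
theorem stmt12
    (Λ : Type*) [AddCommGroup Λ] [Module.Free ℤ Λ] [Module.Finite ℤ Λ]
    (bΛ : Λ →ₗ[ℤ] Λ →ₗ[ℤ] ℤ)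
    (hsymm : ∀ x y : Λ, bΛ x y = bΛ y x)
    (heven : ∀ x : Λ, Even (bΛ x x))
    (hneg : ∀ x : Λ, x ≠ 0 → bΛ x x < 0)
    (hrank : finrank ℤ Λ = 24)
    (hunimodular : Function.Bijective bΛ)
    (hnoroot : ∀ x : Λ, bΛ x x ≠ -2)
    (φ : Λ ≃ₗ[ℤ] Λ)
    (hiso : ∀ x y : Λ, bΛ (φ x) (φ y) = bΛ x y)
    (hord : orderOf φ = 5) :
    (finrank ℤ (orthSub bΛ (fixSub φ)) = 16 ∨
     finrank ℤ (orthSub bΛ (fixSub φ)) = 20 ∨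
     finrank ℤ (orthSub bΛ (fixSub φ)) = 24) ∧
    (finrank ℤ (orthSub bΛ (fixSub φ)) = 20 →
      ∃ e : ↥(fixSub φ) ≃ₗ[ℤ] (Fin 4 → ℤ),
        ∀ x y : ↥(fixSub φ),
          bΛ (x : Λ) (y : Λ) = (e x) ⬝ᵥ (M5n *ᵥ (e y))) ∧
    (finrank ℤ (orthSub bΛ (fixSub φ)) = 24 →
      orthSub bΛ (fixSub φ) = ⊤) := by
  have hp : φ ^ 5 = 1 := by rw [← hord]; exact pow_orderOf_eq_one φ
  let f : Module.End ℤ Λ := φ.toLinearMap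
  have hf : ∀ x, f x = φ x := fun x => rfl
  have h5 : ∀ x, f (f (f (f (f x)))) = x := by
    intro x
    have := LinearEquiv.congr_fun hp x
    simp [pow_succ] at this
    exact this
  have hne : ∃ x, f x ≠ x := by
    by_contra! h
    have h1 : φ = 1 := LinearEquiv.ext h
    rw [h1, orderOf_one] at hord
    norm_num at hord
  have hiso' : ∀ x y : Λ, bΛ (f x) (f y) = bΛ x y := hiso
  have hT : fixSub φ = LinearMap.ker (fsub f) := rfl
  have hnb : ∀ (x y : Λ), f y = y → bΛ (nrm f x) y = 5 * bΛ x y := by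
    intro x y hy
    have h1 : ∀ z : Λ, bΛ (f z) y = bΛ z y := by
      intro z
      have := hiso' z y
      rwa [hy] at this
    rw [nrm_apply]
    simp only [map_add, LinearMap.add_apply, h1]; ring
  have hfix : ∀ y, y ∈ fixSub φ ↔ f y = y := by
    intro y
    rw [hT, LinearMap.mem_ker, fsub_apply, sub_eq_zero]
  have hS : orthSub bΛ (fixSub φ) = LinearMap.ker (nrm f) := by
    ext x
    rw [LinearMap.mem_ker]
    constructor
    · intro hx
      have hx : ∀ y ∈ fixSub φ, bΛ x y = 0 := hx
      by_contra h0
      have h1 := hneg _ h0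
      rw [hnb x _ (f_nrm f h5 x), hx _ ((hfix _).2 (f_nrm f h5 x))] at h1
      norm_num at h1
    · intro hx y hy
      have h1 := hnb x y ((hfix y).1 hy)
      rw [hx, map_zero, LinearMap.zero_apply] at h1
      linarith
  have hadd := rank_add f h5
  rw [hS]
  refine ⟨coinv_rank bΛ hsymm heven hneg hunimodular hnoroot f hiso' h5 hrank hne, ?_, ?_⟩
  · intro h
    exact inv_lattice bΛ hsymm heven hneg hunimodular hnoroot f hiso' h5 (by omega)
  · intro h
    have h0 : LinearMap.ker (fsub f) = ⊥ := Submodule.finrank_eq_zero.1 (by omega)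
    rw [eq_top_iff]
    intro x _
    have h1 : nrm f x ∈ LinearMap.ker (fsub f) := by
      rw [LinearMap.mem_ker, fsub_apply, f_nrm f h5, sub_self]
    rwa [h0, Submodule.mem_bot] at h1
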